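/- Let μ be a probability measure on ℝ² and r > 0. Suppose Q is an axis-parallel square of sidelength r with μ(Q) ≥ 1/200, and suppose every axis-parallel square of sidelength r has μ-measure at most 1/50. If X and Y are independent random vectors each with law μ, then P(‖X−Y‖ ≤ √2·r) ≥ 1/40000 and P(‖X−Y‖ ≥ 2r) ≥ 1/400. -/

import Mathlib

open MeasureTheory ProbabilityTheory

/-- The axis-parallel square `[u, u+s] × [v, v+s]` in `ℝ²`. -/
def axisSquare (u v s : ℝ) : Set (EuclideanSpace ℝ (Fin 2)) :=
  {x | x 0 ∈ Set.Icc u (u + s) ∧ x 1 ∈ Set.Icc v (v + s)}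

theorem measurableSet_axisSquare (u v s : ℝ) : MeasurableSet (axisSquare u v s) := by
  have h (i : Fin 2) : Measurable fun x : EuclideanSpace ℝ (Fin 2) => x i := by fun_prop
  exact (h 0 measurableSet_Icc).inter (h 1 measurableSet_Icc)

/-- An interval of length `n * r` is covered by `n` consecutive intervals of length `r`. -/
theorem exists_mem_Icc_add_mul {a r x : ℝ} {n : ℕ} (hn : 0 < n)
    (hx : x ∈ Set.Icc a (a + n * r)) :
    ∃ i : Fin n, x ∈ Set.Icc (a + i * r) (a + i * r + r) := by
  induction n, hn using Nat.le_induction with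
  | base => exact ⟨0, by simpa using hx⟩
  | succ n hn ih =>
    rcases le_total x (a + n * r) with h | h
    · obtain ⟨i, hi⟩ := ih ⟨hx.1, h⟩
      exact ⟨i.castSucc, by simpa using hi⟩
    · refine ⟨Fin.last n, by simpa using h, ?_⟩
      have := hx.2
      push_cast at this
      simp only [Fin.val_last]
      linarith

theorem axisSquare_mul_subset_iUnion (a b r : ℝ) {n : ℕ} (hn : 0 < n) :
    axisSquare a b (n * r) ⊆
      ⋃ p : Fin n × Fin n, axisSquare (a + p.1 * r) (b + p.2 * r) r := by
  rintro x ⟨h0, h1⟩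
  obtain ⟨i, hi⟩ := exists_mem_Icc_add_mul hn h0
  obtain ⟨j, hj⟩ := exists_mem_Icc_add_mul hn h1
  exact Set.mem_iUnion.2 ⟨(i, j), hi, hj⟩

theorem measure_axisSquare_mul_le (μ : Measure (EuclideanSpace ℝ (Fin 2))) {r : ℝ} {c : ENNReal}
    (h : ∀ u v : ℝ, μ (axisSquare u v r) ≤ c) (a b : ℝ) {n : ℕ} (hn : 0 < n) :
    μ (axisSquare a b (n * r)) ≤ (n * n : ℕ) * c :=
  calc μ (axisSquare a b (n * r))
      ≤ ∑ p : Fin n × Fin n, μ (axisSquare (a + p.1 * r) (b + p.2 * r) r) :=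
        (measure_mono (axisSquare_mul_subset_iUnion a b r hn)).trans
          (measure_iUnion_fintype_le _ _)
    _ ≤ ∑ _p : Fin n × Fin n, c := Finset.sum_le_sum fun p _ => h _ _
    _ = (n * n : ℕ) * c := by simp

theorem norm_sub_le_of_mem_axisSquare {u v r : ℝ} (hr : 0 ≤ r) {x y : EuclideanSpace ℝ (Fin 2)}
    (hx : x ∈ axisSquare u v r) (hy : y ∈ axisSquare u v r) : ‖x - y‖ ≤ √2 * r := by
  obtain ⟨⟨hx0, hx0'⟩, hx1, hx1'⟩ := hx
  obtain ⟨⟨hy0, hy0'⟩, hy1, hy1'⟩ := hy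
  have h0 : |x 0 - y 0| ≤ r := abs_le.2 ⟨by linarith, by linarith⟩
  have h1 : |x 1 - y 1| ≤ r := abs_le.2 ⟨by linarith, by linarith⟩
  rw [← Real.sqrt_sq hr, ← Real.sqrt_mul (by norm_num), EuclideanSpace.norm_eq]
  apply Real.sqrt_le_sqrt
  simp only [Fin.sum_univ_two, PiLp.sub_apply, Real.norm_eq_abs]
  have := pow_le_pow_left₀ (abs_nonneg _) h0 2
  have := pow_le_pow_left₀ (abs_nonneg _) h1 2
  linarith

theorem le_norm_sub_of_notMem_axisSquare {u v r d : ℝ} {x y : EuclideanSpace ℝ (Fin 2)}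
    (hx : x ∈ axisSquare u v r) (hy : y ∉ axisSquare (u - d) (v - d) (r + 2 * d)) :
    d ≤ ‖x - y‖ := by
  by_contra! h
  apply hy
  have h0 := abs_le.1 ((PiLp.norm_apply_le (x - y) 0).trans h.le)
  have h1 := abs_le.1 ((PiLp.norm_apply_le (x - y) 1).trans h.le)
  simp only [PiLp.sub_apply] at h0 h1
  obtain ⟨⟨hx0, hx0'⟩, hx1, hx1'⟩ := hx
  exact ⟨⟨by linarith, by linarith⟩, by linarith, by linarith⟩

/-- Suppose `Q` is an axis-parallel square of sidelength `r` with
`μ(Q) ≥ 1/200` and every axis-parallel square of sidelength `r` has `μ`-measure `≤ 1/50`.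
If `X, Y` are independent random vectors with law `μ`, then
`P(‖X−Y‖ ≤ √2·r) ≥ 1/40000` and `P(‖X−Y‖ ≥ 2r) ≥ 1/400`. -/
theorem distance_spread_of_square_bounds
    {Ω : Type*} [MeasurableSpace Ω] (P : Measure Ω) [IsProbabilityMeasure P]
    (μ : Measure (EuclideanSpace ℝ (Fin 2))) [IsProbabilityMeasure μ]
    (r : ℝ) (hr : 0 < r) (u v : ℝ)
    (hQ : (1 / 200 : ENNReal) ≤ μ (axisSquare u v r))
    (hall : ∀ u' v' : ℝ, μ (axisSquare u' v' r) ≤ 1 / 50)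
    (X Y : Ω → EuclideanSpace ℝ (Fin 2)) (hX : Measurable X) (hY : Measurable Y)
    (hindep : IndepFun X Y P)
    (hlawX : Measure.map X P = μ) (hlawY : Measure.map Y P = μ) :
    (1 / 40000 : ENNReal) ≤ P {ω | ‖X ω - Y ω‖ ≤ Real.sqrt 2 * r} ∧
      (1 / 400 : ENNReal) ≤ P {ω | 2 * r ≤ ‖X ω - Y ω‖} := by
  have hmeas := measurableSet_axisSquare
  have hmapX {A : Set (EuclideanSpace ℝ (Fin 2))} (hA : MeasurableSet A) :
      P (X ⁻¹' A) = μ A := by rw [← hlawX, Measure.map_apply hX hA]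
  have hmapY {A : Set (EuclideanSpace ℝ (Fin 2))} (hA : MeasurableSet A) :
      P (Y ⁻¹' A) = μ A := by rw [← hlawY, Measure.map_apply hY hA]
  have hprod {A B : Set (EuclideanSpace ℝ (Fin 2))} (hA : MeasurableSet A)
      (hB : MeasurableSet B) : P (X ⁻¹' A ∩ Y ⁻¹' B) = μ A * μ B := by
    rw [hindep.measure_inter_preimage_eq_mul A B hA hB, hmapX hA, hmapY hB]
  constructor
  · calc (1 / 40000 : ENNReal) = 1 / 200 * (1 / 200) := by
          simp only [one_div]
          rw [← ENNReal.mul_inv (by norm_num) (by norm_num)]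
          norm_num
      _ ≤ μ (axisSquare u v r) * μ (axisSquare u v r) := by gcongr
      _ = P (X ⁻¹' axisSquare u v r ∩ Y ⁻¹' axisSquare u v r) :=
          (hprod (hmeas _ _ _) (hmeas _ _ _)).symm
      _ ≤ _ := measure_mono fun ω hω => norm_sub_le_of_mem_axisSquare hr.le hω.1 hω.2
  · set S := axisSquare (u - 2 * r) (v - 2 * r) (r + 2 * (2 * r)) with hS
    have hSle : μ S ≤ 1 / 2 := by
      have h := measure_axisSquare_mul_le μ hall (u - 2 * r) (v - 2 * r) (n := 5) (by norm_num)
      have h5 : ((5 : ℕ) : ℝ) * r = r + 2 * (2 * r) := by push_cast; ring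
      rw [h5, ← hS] at h
      refine h.trans_eq ?_
      rw [← ENNReal.toReal_eq_toReal_iff' (by finiteness) (by finiteness)]
      norm_num
    have hSc : 1 / 2 ≤ μ Sᶜ := by
      rw [prob_compl_eq_one_sub (hmeas _ _ _)]
      calc (1 / 2 : ENNReal) = 1 - 1 / 2 := by simp
        _ ≤ 1 - μ S := by gcongr
    calc (1 / 400 : ENNReal) = 1 / 200 * (1 / 2) := by
          simp only [one_div]
          rw [← ENNReal.mul_inv (by norm_num) (by norm_num)]
          norm_num
      _ ≤ μ (axisSquare u v r) * μ Sᶜ := by gcongr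
      _ = P (X ⁻¹' axisSquare u v r ∩ Y ⁻¹' Sᶜ) :=
          (hprod (hmeas _ _ _) (hmeas _ _ _).compl).symm
      _ ≤ _ := measure_mono fun ω hω => le_norm_sub_of_notMem_axisSquare hω.1 hω.2
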